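/- Gaussian-weighted integration by parts on ℝ^n without compact support (Corollary 3.4 of the paper in the case where the complete self-shrinker is the plane ℝ^n): if u, v : ℝ^n → ℝ are twice continuously differentiable and ∫_{ℝ^n} ( |u(x)|·‖∇v(x)‖ + ‖∇u(x)‖·‖∇v(x)‖ + |u(x)·𝓛v(x)| ) e^{−‖x‖²/2} dx < ∞, where 𝓛v(x) = Δv(x) − ⟨x, ∇v(x)⟩, then ∫_{ℝ^n} u(x) 𝓛v(x) e^{−‖x‖²/2} dx = − ∫_{ℝ^n} ⟨∇v(x), ∇u(x)⟩ e^{−‖x‖²/2} dx. -/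

import Mathlib

open MeasureTheory Real
open scoped RealInnerProductSpace

/-- The Laplacian of a function `v : ℝ^n → ℝ`: the trace of its Hessian, i.e. the sum of
its second partial derivatives. -/
noncomputable def laplacian {n : ℕ} (v : EuclideanSpace ℝ (Fin n) → ℝ)
    (x : EuclideanSpace ℝ (Fin n)) : ℝ :=
  LinearMap.trace ℝ (EuclideanSpace ℝ (Fin n)) (fderiv ℝ (gradient v) x).toLinearMap

/-- The drift Laplacian `𝓛v(x) = Δv(x) - ⟨x, ∇v(x)⟩` on `ℝⁿ`. -/
noncomputable def driftLaplacian {n : ℕ} (v : EuclideanSpace ℝ (Fin n) → ℝ)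
    (x : EuclideanSpace ℝ (Fin n)) : ℝ :=
  laplacian v x - ⟪x, gradient v x⟫

open Filter Topology in
/-- The divergence theorem on a finite-dimensional Euclidean space: the divergence of an
integrable `C¹` vector field has zero integral as soon as it is integrable. -/
theorem integral_trace_fderiv_eq_zero {E : Type*} [NormedAddCommGroup E]
    [InnerProductSpace ℝ E] [FiniteDimensional ℝ E] [MeasurableSpace E] [BorelSpace E]
    {W : E → E} (hW : ContDiff ℝ 1 W) (hWi : Integrable W)
    (hdiv : Integrable fun x => LinearMap.trace ℝ E (fderiv ℝ W x).toLinearMap) :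
    ∫ x, LinearMap.trace ℝ E (fderiv ℝ W x).toLinearMap = 0 := by
  set b := stdOrthonormalBasis ℝ E
  have hWd : Differentiable ℝ W := hW.differentiable one_ne_zero
  have hW' : Continuous (fderiv ℝ W) := hW.continuous_fderiv one_ne_zero
  have cutoff_parts : ∀ ψ : E → ℝ, ContDiff ℝ 1 ψ → HasCompactSupport ψ →
      ∫ x, ψ x * LinearMap.trace ℝ E (fderiv ℝ W x).toLinearMap =
        -∫ x, fderiv ℝ ψ x (W x) := by
    intro ψ hψ hψc
    have hψ' : Continuous (fderiv ℝ ψ) := hψ.continuous_fderiv one_ne_zero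
    have comp_deriv : ∀ i x, fderiv ℝ (fun y => ⟪b i, W y⟫) x (b i) =
        ⟪b i, fderiv ℝ W x (b i)⟫ := by
      intro i x
      have := ((innerSL ℝ (b i)).hasFDerivAt.comp x (hWd x).hasFDerivAt).fderiv
      exact congrArg (fun L => L (b i)) this
    have h_int : ∀ i, Integrable fun x => ψ x * ⟪b i, fderiv ℝ W x (b i)⟫ := fun i =>
      (by fun_prop : Continuous fun x => ψ x * ⟪b i, fderiv ℝ W x (b i)⟫)
        |>.integrable_of_hasCompactSupport hψc.mul_right
    have h_int' : ∀ i, Integrable fun x => fderiv ℝ ψ x (b i) * ⟪b i, W x⟫ := fun i =>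
      (by fun_prop : Continuous fun x => fderiv ℝ ψ x (b i) * ⟪b i, W x⟫)
        |>.integrable_of_hasCompactSupport (hψc.fderiv_apply ℝ (b i)).mul_right
    have parts : ∀ i, ∫ x, ψ x * ⟪b i, fderiv ℝ W x (b i)⟫ =
        -∫ x, fderiv ℝ ψ x (b i) * ⟪b i, W x⟫ := by
      intro i
      simp_rw [← comp_deriv]
      refine integral_mul_fderiv_eq_neg_fderiv_mul_of_integrable (h_int' i) ?_ ?_
        (fun x _ => hψ.differentiable one_ne_zero x) (fun x _ => (differentiableAt_const (b i)).inner ℝ (hWd x))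
      · simpa only [comp_deriv] using h_int i
      · exact (by fun_prop : Continuous fun x => ψ x * ⟪b i, W x⟫)
          |>.integrable_of_hasCompactSupport hψc.mul_right
    have expand : ∀ x, fderiv ℝ ψ x (W x) = ∑ i, fderiv ℝ ψ x (b i) * ⟪b i, W x⟫ := by
      intro x
      conv_lhs => rw [← b.sum_repr' (W x)]
      simp [mul_comm]
    simp_rw [expand, LinearMap.trace_eq_sum_inner _ b, Finset.mul_sum]
    rw [integral_finsetSum _ fun i _ => h_int' i, ← Finset.sum_neg_distrib]
    exact (integral_finsetSum _ fun i _ => h_int i).trans (Finset.sum_congr rfl fun i _ => parts i)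
  let φ : ContDiffBump (0 : E) := ⟨1, 2, one_pos, one_lt_two⟩
  have hφ : ContDiff ℝ 1 φ := φ.contDiff
  have hφ' : Continuous (fderiv ℝ φ) := hφ.continuous_fderiv one_ne_zero
  obtain ⟨C, hC⟩ := hφ'.bounded_above_of_compact_support (φ.hasCompactSupport.fderiv ℝ)
  let ε : ℕ → ℝ := fun k => 1 / ((k : ℝ) + 1)
  have hε : Tendsto ε atTop (𝓝 0) := tendsto_one_div_add_atTop_nhds_zero_nat
  have ε_pos : ∀ k, 0 < ε k := fun k => Nat.one_div_pos_of_nat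
  have scaled_deriv : ∀ k x, fderiv ℝ (fun y => φ (ε k • y)) x = ε k • fderiv ℝ φ (ε k • x) :=
    fun k x => fderiv_comp_smul (ε k)
  have scaled_parts : ∀ k,
      ∫ x, φ (ε k • x) * LinearMap.trace ℝ E (fderiv ℝ W x).toLinearMap =
        -∫ x, ε k * fderiv ℝ φ (ε k • x) (W x) := by
    intro k
    rw [cutoff_parts (fun x => φ (ε k • x)) (hφ.comp (contDiff_const_smul (ε k)))
      (φ.hasCompactSupport.comp_homeomorph (Homeomorph.smulOfNeZero (ε k) (ε_pos k).ne'))]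
    simp [scaled_deriv]
  have lim_left : Tendsto
      (fun k => ∫ x, φ (ε k • x) * LinearMap.trace ℝ E (fderiv ℝ W x).toLinearMap) atTop
      (𝓝 (∫ x, LinearMap.trace ℝ E (fderiv ℝ W x).toLinearMap)) := by
    refine tendsto_integral_of_dominated_convergence _ (fun k => ?_) hdiv.norm
      (fun k => ?_) ?_
    · exact (by fun_prop : Continuous fun x => φ (ε k • x)).aestronglyMeasurable.mul
        hdiv.aestronglyMeasurable
    · refine Eventually.of_forall fun x => ?_
      rw [norm_mul, Real.norm_of_nonneg φ.nonneg]
      exact mul_le_of_le_one_left (norm_nonneg _) φ.le_one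
    · refine Eventually.of_forall fun x => ?_
      have h0 : Tendsto (fun k => φ (ε k • x)) atTop (𝓝 (φ ((0 : ℝ) • x))) :=
        (hφ.continuous.tendsto _).comp (hε.smul_const x)
      have h1 : φ ((0 : ℝ) • x) = 1 := φ.one_of_mem_closedBall (by simp [φ])
      rw [h1] at h0
      simpa using h0.mul_const (LinearMap.trace ℝ E (fderiv ℝ W x).toLinearMap)
  have lim_right : Tendsto (fun k => -∫ x, ε k * fderiv ℝ φ (ε k • x) (W x)) atTop (𝓝 0) := by
    refine squeeze_zero_norm (a := fun k => ε k * ∫ x, C * ‖W x‖) (fun k => ?_)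
      (by simpa using hε.mul_const (∫ x, C * ‖W x‖))
    rw [norm_neg, integral_const_mul, norm_mul, Real.norm_of_nonneg (ε_pos k).le]
    exact mul_le_mul_of_nonneg_left (norm_integral_le_of_norm_le (hWi.norm.const_mul C)
      (Eventually.of_forall fun x => ContinuousLinearMap.le_of_opNorm_le _ (hC _) _)) (ε_pos k).le
  simp_rw [scaled_parts] at lim_left
  exact tendsto_nhds_unique lim_left lim_right

theorem ContDiff.gradient {E : Type*} [NormedAddCommGroup E] [InnerProductSpace ℝ E]
    [CompleteSpace E] {f : E → ℝ} {m k : WithTop ℕ∞} (hf : ContDiff ℝ k f) (hmk : m + 1 ≤ k) :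
    ContDiff ℝ m (gradient f) :=
  (InnerProductSpace.toDual ℝ E).symm.contDiff.comp (hf.fderiv_right hmk)

theorem hasFDerivAt_exp_neg_norm_sq_div_two {E : Type*} [NormedAddCommGroup E]
    [InnerProductSpace ℝ E] (x : E) :
    HasFDerivAt (fun y : E => Real.exp (-‖y‖ ^ 2 / 2))
      (-Real.exp (-‖x‖ ^ 2 / 2) • innerSL ℝ x) x := by
  have h := (((hasStrictFDerivAt_norm_sq x).hasFDerivAt.neg).mul_const (2⁻¹ : ℝ)).exp
  refine (h.congr_fderiv ?_ : HasFDerivAt _ _ x)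
  ext y
  simp [div_eq_mul_inv]

/-- The Gaussian-weighted divergence identity
`div (u e^{-‖x‖²/2} ∇v) = (u 𝓛v + ⟨∇v, ∇u⟩) e^{-‖x‖²/2}`. -/
theorem trace_fderiv_gaussian_smul_gradient {n : ℕ} {u v : EuclideanSpace ℝ (Fin n) → ℝ}
    {x : EuclideanSpace ℝ (Fin n)} (hu : DifferentiableAt ℝ u x)
    (hv : DifferentiableAt ℝ (gradient v) x) :
    LinearMap.trace ℝ (EuclideanSpace ℝ (Fin n))
      (fderiv ℝ (fun y => (u y * Real.exp (-‖y‖ ^ 2 / 2)) • gradient v y) x).toLinearMap =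
    u x * driftLaplacian v x * Real.exp (-‖x‖ ^ 2 / 2) +
      ⟪gradient v x, gradient u x⟫ * Real.exp (-‖x‖ ^ 2 / 2) := by
  have h := (hu.hasFDerivAt.fun_mul (hasFDerivAt_exp_neg_norm_sq_div_two x)).fun_smul hv.hasFDerivAt
  have trace_rank_one : ∀ L : EuclideanSpace ℝ (Fin n) →L[ℝ] ℝ,
      LinearMap.trace ℝ (EuclideanSpace ℝ (Fin n)) (L.smulRight (gradient v x)).toLinearMap =
        L (gradient v x) := fun L => LinearMap.trace_smulRight L.toLinearMap (gradient v x)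
  rw [HasFDerivAt.fderiv h, ContinuousLinearMap.toLinearMap_add, map_add, trace_rank_one,
    ContinuousLinearMap.toLinearMap_smul, map_smul, driftLaplacian, laplacian, real_inner_comm,
    inner_gradient_left]
  simp
  ring

/-- Gaussian-weighted integration by parts on `ℝⁿ` without compact support: if `u, v` are
`C²` and `∫ (|u|·‖∇v‖ + ‖∇u‖·‖∇v‖ + |u·𝓛v|) e^{-‖x‖²/2} < ∞`, then
`∫ u 𝓛v e^{-‖x‖²/2} = -∫ ⟨∇v, ∇u⟩ e^{-‖x‖²/2}`. -/
theorem gaussian_integration_by_parts_noncompact {n : ℕ}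
    (u v : EuclideanSpace ℝ (Fin n) → ℝ)
    (hu : ContDiff ℝ 2 u) (hv : ContDiff ℝ 2 v)
    (hint : Integrable (fun x : EuclideanSpace ℝ (Fin n) =>
      (|u x| * ‖gradient v x‖ + ‖gradient u x‖ * ‖gradient v x‖ +
        |u x * driftLaplacian v x|) * Real.exp (-‖x‖ ^ 2 / 2))) :
    ∫ x, u x * driftLaplacian v x * Real.exp (-‖x‖ ^ 2 / 2) =
      -∫ x, ⟪gradient v x, gradient u x⟫ * Real.exp (-‖x‖ ^ 2 / 2) := by
  have hgu : ContDiff ℝ 1 (gradient u) := hu.gradient (by norm_num)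
  have hgv : ContDiff ℝ 1 (gradient v) := hv.gradient (by norm_num)
  have hu1 : ContDiff ℝ 1 u := hu.of_le one_le_two
  have hgauss : ContDiff ℝ 1 fun x : EuclideanSpace ℝ (Fin n) => Real.exp (-‖x‖ ^ 2 / 2) :=
    ((contDiff_norm_sq ℝ).neg.div_const 2).exp
  have hcu := hu.continuous
  have hcgu := hgu.continuous
  have hcgv := hgv.continuous
  have hlap : Continuous (driftLaplacian v) := by
    have htr : Continuous fun L : EuclideanSpace ℝ (Fin n) →L[ℝ] EuclideanSpace ℝ (Fin n) =>
        LinearMap.trace ℝ (EuclideanSpace ℝ (Fin n)) L.toLinearMap :=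
      ((LinearMap.trace ℝ (EuclideanSpace ℝ (Fin n))) ∘ₗ
        (ContinuousLinearMap.coeLM ℝ)).continuous_of_finiteDimensional
    exact (htr.comp (hgv.continuous_fderiv one_ne_zero)).sub (by fun_prop)
  have hi₁ : Integrable fun x => u x * driftLaplacian v x * Real.exp (-‖x‖ ^ 2 / 2) := by
    refine hint.mono' (by fun_prop) (.of_forall fun x => ?_)
    rw [norm_mul, Real.norm_of_nonneg (Real.exp_pos _).le, Real.norm_eq_abs]
    gcongr
    exact le_add_of_nonneg_left (by positivity)
  have hi₂ : Integrable fun x => ⟪gradient v x, gradient u x⟫ * Real.exp (-‖x‖ ^ 2 / 2) := by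
    refine hint.mono' (by fun_prop) (.of_forall fun x => ?_)
    rw [norm_mul, Real.norm_of_nonneg (Real.exp_pos _).le, real_inner_comm]
    gcongr
    refine (norm_inner_le_norm _ _).trans ?_
    rw [add_right_comm]
    exact le_add_of_nonneg_left (by positivity)
  have hi₃ : Integrable fun x => (u x * Real.exp (-‖x‖ ^ 2 / 2)) • gradient v x := by
    refine hint.mono' (by fun_prop) (.of_forall fun x => ?_)
    rw [norm_smul, norm_mul, Real.norm_of_nonneg (Real.exp_pos _).le, Real.norm_eq_abs,
      mul_right_comm, add_assoc]
    gcongr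
    exact le_add_of_nonneg_right (by positivity)
  have hdiv := fun x => trace_fderiv_gaussian_smul_gradient
    (hu1.differentiable one_ne_zero x) (hgv.differentiable one_ne_zero x)
  have h := integral_trace_fderiv_eq_zero
    (W := fun x => (u x * Real.exp (-‖x‖ ^ 2 / 2)) • gradient v x)
    ((hu1.mul hgauss).smul hgv) hi₃ (by simp_rw [hdiv]; exact hi₁.add hi₂)
  simp_rw [hdiv] at h
  rw [integral_add hi₁ hi₂] at h
  exact eq_neg_of_add_eq_zero_left h
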